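/- Consider a scaling satisfying the scaling condition Λ_m(n) = c_n (log n)/n with lim_{n→∞} c_n = c, where 0 < c < 1, and assume that either (a) lim_{n→∞} α_{md}(n) log n = 0, or (b) α_{md}(n) log n converges (in [0,∞]) to some α* ∈ (0,∞] and α_{mm}(n) log n converges (in [0,∞]) to some α** ∈ (0,∞]. Let x_{n,1} and x_{n,2} be the indicator random variables of the events that in H(n; μ, Θ_n) vertex v_1 (respectively v_2) has type m(n) and is isolated. Then limsup_{n→∞} E[x_{n,1} x_{n,2}] / (E[x_{n,1}])² ≤ 1. -/

import Mathlib

open MeasureTheory Finset Filter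

/-- Edge probability between a class-`i` node and a class-`j` node in the
inhomogeneous random key graph. -/
noncomputable def pEdge (P : ℕ) {r : ℕ} (K : Fin r → ℕ) (i j : Fin r) : ℝ :=
  if K i + K j ≤ P then
    1 - ((P - K i).choose (K j) : ℝ) / (P.choose (K j) : ℝ)
  else 1

/-- Mean edge probability `Λ_i` of a class-`i` node in the intersection model. -/
noncomputable def LamE {r : ℕ} (μ : Fin r → ℝ) (α : Fin r → Fin r → ℝ)
    (P : ℕ) (K : Fin r → ℕ) (i : Fin r) : ℝ :=
  ∑ j, μ j * (α i j * pEdge P K i j)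

/-- Minimum mean edge probability `Λ_m`. -/
noncomputable def LamMin {r : ℕ} (μ : Fin r → ℝ) (α : Fin r → Fin r → ℝ)
    (P : ℕ) (K : Fin r → ℕ) : ℝ :=
  ⨅ i, LamE μ α P K i

/-- The random graph `H(n; μ, Θ)`: random types (distribution `μ`), random key
rings (uniform `K`-subsets of a `P`-pool, given types), and random channel
indicators (Bernoulli `α_{ij}`, given types), all with the joint distribution
described by the field `joint`. -/
structure HetModel (r n P : ℕ) (K : Fin r → ℕ) (μ : Fin r → ℝ)
    (α : Fin r → Fin r → ℝ) (Ω : Type) [MeasurableSpace Ω]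
    (Pr : Measure Ω) : Type where
  typ : Ω → Fin n → Fin r
  keyring : Ω → Fin n → Finset (Fin P)
  chan : Ω → Fin n → Fin n → Bool
  joint : ∀ (t₀ : Fin n → Fin r) (σ₀ : Fin n → Finset (Fin P))
      (b₀ : Fin n → Fin n → Bool),
      Pr {ω | typ ω = t₀ ∧ keyring ω = σ₀ ∧
              ∀ x y : Fin n, x < y → chan ω x y = b₀ x y}
        = ENNReal.ofReal
            ((∏ x, μ (t₀ x)) *
             (∏ x, if (σ₀ x).card = K (t₀ x)
                   then ((P.choose (K (t₀ x)) : ℝ))⁻¹ else 0) *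
             (∏ x : Fin n, ∏ y ∈ univ.filter (fun y => x < y),
                (if b₀ x y then α (t₀ x) (t₀ y) else 1 - α (t₀ x) (t₀ y))))

variable {r n P : ℕ} {K : Fin r → ℕ} {μ : Fin r → ℝ} {α : Fin r → Fin r → ℝ}
  {Ω : Type} [MeasurableSpace Ω] {Pr : Measure Ω}

/-- Adjacency in `H(n; μ, Θ)`: distinct vertices sharing a key whose channel is on. -/
def HetModel.Adj (M : HetModel r n P K μ α Ω Pr) (ω : Ω) (x y : Fin n) : Prop :=
  x ≠ y ∧ ((M.keyring ω x) ∩ (M.keyring ω y)).Nonempty ∧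
    (if x < y then M.chan ω x y else M.chan ω y x) = true

/-- A vertex is isolated if it is adjacent to no other vertex. -/
def HetModel.Isolated (M : HetModel r n P K μ α Ω Pr) (ω : Ω) (x : Fin n) : Prop :=
  ∀ y : Fin n, ¬ M.Adj ω x y

/-- Probability that a vertex has type `v.1` and key ring `v.2`. -/
noncomputable def labelWeight (μ : Fin r → ℝ) (K : Fin r → ℕ)
    (v : Fin r × Finset (Fin P)) : ℝ :=
  μ v.1 * if v.2.card = K v.1 then ((P.choose (K v.1) : ℝ))⁻¹ else 0

/-- Conditional probability that two vertices with given types and key rings are adjacent. -/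
noncomputable def edgeProb (α : Fin r → Fin r → ℝ) (v v' : Fin r × Finset (Fin P)) : ℝ :=
  if (v.2 ∩ v'.2).Nonempty then α v.1 v'.1 else 0

/-- Probability that the channel indicator of `x < y` equals `β`; indicators with `y ≤ x` are
forced to be `false`. -/
noncomputable def chanWeight (α : Fin r → Fin r → ℝ) (s : Fin n → Fin r × Finset (Fin P))
    (x y : Fin n) (β : Bool) : ℝ :=
  if x < y then (if β then α (s x).1 (s y).1 else 1 - α (s x).1 (s y).1)
  else if β then 0 else 1

/-- Joint probability of a labelling `s` and channel indicators `b`. -/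
noncomputable def configWeight (μ : Fin r → ℝ) (K : Fin r → ℕ) (α : Fin r → Fin r → ℝ)
    (s : Fin n → Fin r × Finset (Fin P)) (b : Fin n → Fin n → Bool) : ℝ :=
  (∏ x, labelWeight μ K (s x)) * ∏ x, ∏ y, chanWeight α s x y (b x y)

/-- All vertices in `A` have type `i` and are isolated. -/
def IsolatedOn (A : Fin n → Prop) (i : Fin r) (s : Fin n → Fin r × Finset (Fin P))
    (b : Fin n → Fin n → Bool) : Prop :=
  ∀ x, A x → (s x).1 = i ∧ ∀ y, ¬ (x ≠ y ∧ ((s x).2 ∩ (s y).2).Nonempty ∧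
    (if x < y then b x y else b y x) = true)

open Classical in
/-- Sum of the configuration weights over the event `IsolatedOn A i`, with the channel
indicators summed out. -/
noncomputable def isolatedWeight (μ : Fin r → ℝ) (K : Fin r → ℕ) (α : Fin r → Fin r → ℝ)
    (P : ℕ) (A : Fin n → Prop) (i : Fin r) : ℝ :=
  ∑ s : Fin n → Fin r × Finset (Fin P),
    (∏ x, (labelWeight μ K (s x) * if A x → (s x).1 = i then 1 else 0)) *
      ∏ x, ∏ y, (if x < y ∧ (A x ∨ A y) then 1 - edgeProb α (s x) (s y) else 1)

theorem sum_prod_prod_bool (f : Fin n → Fin n → Bool → ℝ) :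
    ∑ b : Fin n → Fin n → Bool, ∏ x, ∏ y, f x y (b x y) = ∏ x, ∏ y, ∑ β, f x y β := by
  simp_rw [Finset.prod_univ_sum, Fintype.piFinset_univ]

open Classical in
theorem isolatedOn_indicator (A : Fin n → Prop) (i : Fin r)
    (s : Fin n → Fin r × Finset (Fin P)) (b : Fin n → Fin n → Bool) :
    (if IsolatedOn A i s b then (1 : ℝ) else 0) =
      (∏ x, if A x → (s x).1 = i then 1 else 0) *
        ∏ x, ∏ y, (if x < y ∧ (A x ∨ A y) ∧ ((s x).2 ∩ (s y).2).Nonempty ∧ b x y = true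
          then 0 else 1) := by
  by_cases h : IsolatedOn A i s b
  · rw [if_pos h, Finset.prod_eq_one, Finset.prod_eq_one, one_mul]
    · intro x _
      refine Finset.prod_eq_one fun y _ => if_neg ?_
      rintro ⟨hxy, hA | hA, hne, hb⟩
      · exact (h x hA).2 y ⟨hxy.ne, hne, by simpa [hxy] using hb⟩
      · exact (h y hA).2 x ⟨hxy.ne', by rwa [Finset.inter_comm], by simpa [hxy.not_gt] using hb⟩
    · intro x _
      exact if_pos fun hA => (h x hA).1
  · rw [if_neg h]
    by_contra hne
    have hne := Ne.symm hne
    rw [mul_ne_zero_iff, Finset.prod_ne_zero_iff, Finset.prod_ne_zero_iff] at hne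
    obtain ⟨h1, h2⟩ := hne
    have h2' : ∀ x y, ¬ (x < y ∧ (A x ∨ A y) ∧ ((s x).2 ∩ (s y).2).Nonempty ∧ b x y = true) := by
      intro x y hc
      have := Finset.prod_ne_zero_iff.1 (h2 x (Finset.mem_univ _)) y (Finset.mem_univ _)
      exact this (if_pos hc)
    apply h
    intro x hA
    refine ⟨?_, ?_⟩
    · by_contra hc
      exact h1 x (Finset.mem_univ _) (if_neg fun h => hc (h hA))
    · rintro y ⟨hxy, hne, hb⟩
      rcases lt_or_gt_of_ne hxy with hlt | hlt
      · exact h2' x y ⟨hlt, Or.inl hA, hne, by simpa [hlt] using hb⟩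
      · exact h2' y x ⟨hlt, Or.inr hA, by rwa [Finset.inter_comm], by
          simpa [hlt.not_gt] using hb⟩

open Classical in
theorem sum_configWeight_isolatedOn (μ : Fin r → ℝ) (K : Fin r → ℕ) (α : Fin r → Fin r → ℝ)
    (P : ℕ) (A : Fin n → Prop) (i : Fin r) :
    ∑ q : (Fin n → Fin r × Finset (Fin P)) × (Fin n → Fin n → Bool),
      (if IsolatedOn A i q.1 q.2 then configWeight μ K α q.1 q.2 else 0) =
      isolatedWeight μ K α P A i := by
  rw [Fintype.sum_prod_type, isolatedWeight]
  refine Finset.sum_congr rfl fun s _ => ?_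
  have key : ∀ b : Fin n → Fin n → Bool,
      (if IsolatedOn A i s b then configWeight μ K α s b else 0) =
      (∏ x, (labelWeight μ K (s x) * if A x → (s x).1 = i then 1 else 0)) *
        ∏ x, ∏ y, (chanWeight α s x y (b x y) *
          if x < y ∧ (A x ∨ A y) ∧ ((s x).2 ∩ (s y).2).Nonempty ∧ b x y = true
          then 0 else 1) := by
    intro b
    rw [← mul_boole, isolatedOn_indicator, configWeight]
    simp_rw [Finset.prod_mul_distrib]
    ring
  rw [Finset.sum_congr rfl fun b _ => key b, ← Finset.mul_sum]
  congr 1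
  rw [sum_prod_prod_bool (fun x y β => chanWeight α s x y β *
          if x < y ∧ (A x ∨ A y) ∧ ((s x).2 ∩ (s y).2).Nonempty ∧ β = true
          then 0 else 1)]
  refine Finset.prod_congr rfl fun x _ => Finset.prod_congr rfl fun y _ => ?_
  rw [Fintype.sum_bool, chanWeight, chanWeight, edgeProb]
  by_cases hxy : x < y <;> by_cases hA : A x ∨ A y <;>
    by_cases hne : ((s x).2 ∩ (s y).2).Nonempty <;> simp [hxy, hA, hne]

theorem labelWeight_nonneg (hμ : ∀ i, 0 ≤ μ i) (v : Fin r × Finset (Fin P)) :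
    0 ≤ labelWeight μ K v := by
  unfold labelWeight
  have := hμ v.1
  positivity

theorem configWeight_nonneg (hμ : ∀ i, 0 ≤ μ i) (hα0 : ∀ i j, 0 ≤ α i j)
    (hα1 : ∀ i j, α i j ≤ 1) (s : Fin n → Fin r × Finset (Fin P)) (b : Fin n → Fin n → Bool) :
    0 ≤ configWeight μ K α s b := by
  refine mul_nonneg (Finset.prod_nonneg fun x _ => labelWeight_nonneg hμ _)
    (Finset.prod_nonneg fun x _ => Finset.prod_nonneg fun y _ => ?_)
  have h0 := hα0 (s x).1 (s y).1
  have h1 := hα1 (s x).1 (s y).1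
  unfold chanWeight
  split_ifs <;> linarith

theorem sum_labelWeight_mul (f : Fin r × Finset (Fin P) → ℝ) :
    ∑ v, labelWeight μ K v * f v =
      ∑ j, μ j * ((∑ S ∈ powersetCard (K j) (univ : Finset (Fin P)), f (j, S)) /
        (P.choose (K j) : ℝ)) := by
  rw [Fintype.sum_prod_type]
  refine Finset.sum_congr rfl fun j _ => ?_
  rw [← Finset.univ_filter_card_eq, Finset.sum_filter, div_eq_inv_mul, Finset.mul_sum,
    Finset.mul_sum]
  refine Finset.sum_congr rfl fun S _ => ?_
  simp only [labelWeight]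
  split_ifs <;> ring

theorem sum_labelWeight (hμsum : ∑ i, μ i = 1) (hK : ∀ i, K i ≤ P) :
    ∑ v : Fin r × Finset (Fin P), labelWeight μ K v = 1 := by
  have h := sum_labelWeight_mul (μ := μ) (K := K) (P := P) (fun _ => 1)
  simp only [mul_one] at h
  rw [h]
  refine Eq.trans (Finset.sum_congr rfl fun j _ => ?_) hμsum
  have : (P.choose (K j) : ℝ) ≠ 0 := by
    exact_mod_cast (Nat.choose_pos (hK j)).ne'
  simp [this]

theorem isolatedWeight_false (hμsum : ∑ i, μ i = 1) (hK : ∀ i, K i ≤ P) (i : Fin r) :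
    isolatedWeight μ K α P (fun _ : Fin n => False) i = 1 := by
  have h := Finset.prod_univ_sum (fun _ : Fin n => (univ : Finset (Fin r × Finset (Fin P))))
    (fun _ v => labelWeight μ K v)
  rw [Fintype.piFinset_univ] at h
  simp [isolatedWeight, ← h, sum_labelWeight hμsum hK]

/-- Configuration of the model at an outcome, with channel indicators cleared off `x < y`. -/
def HetModel.config (M : HetModel r n P K μ α Ω Pr) (ω : Ω) :
    (Fin n → Fin r × Finset (Fin P)) × (Fin n → Fin n → Bool) :=
  (fun x => (M.typ ω x, M.keyring ω x), fun x y => decide (x < y) && M.chan ω x y)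

theorem HetModel.measure_config_le (M : HetModel r n P K μ α Ω Pr)
    (q : (Fin n → Fin r × Finset (Fin P)) × (Fin n → Fin n → Bool)) :
    Pr {ω | M.config ω = q} ≤ ENNReal.ofReal (configWeight μ K α q.1 q.2) := by
  obtain ⟨s, b⟩ := q
  by_cases hb : ∀ x y, ¬ x < y → b x y = false
  · have hsub : {ω | M.config ω = (s, b)} ⊆ {ω | M.typ ω = (fun x => (s x).1) ∧
        M.keyring ω = (fun x => (s x).2) ∧ ∀ x y : Fin n, x < y → M.chan ω x y = b x y} := by
      rintro ω h
      simp only [HetModel.config, Set.mem_ofPred_eq, Prod.mk.injEq] at h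
      obtain ⟨rfl, rfl⟩ := h
      exact ⟨rfl, rfl, fun x y hxy => by simp [hxy]⟩
    refine (measure_mono hsub).trans (le_of_eq ?_)
    rw [M.joint, configWeight]
    congr 1
    congr 1
    · simp only [labelWeight, Finset.prod_mul_distrib]
    · refine Finset.prod_congr rfl fun x _ => ?_
      rw [Finset.prod_filter]
      refine Finset.prod_congr rfl fun y _ => ?_
      unfold chanWeight
      by_cases hxy : x < y
      · simp [hxy]
      · simp [hxy, hb x y hxy]
  · have : {ω | M.config ω = (s, b)} = ∅ := by
      rw [Set.eq_empty_iff_forall_notMem]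
      intro ω h
      simp only [HetModel.config, Set.mem_ofPred_eq, Prod.mk.injEq] at h
      apply hb
      intro x y hxy
      rw [← h.2]
      simp [hxy]
    simp [this]

open Classical in
theorem HetModel.measure_preimage_le (M : HetModel r n P K μ α Ω Pr) (hμ : ∀ i, 0 ≤ μ i)
    (hα0 : ∀ i j, 0 ≤ α i j) (hα1 : ∀ i j, α i j ≤ 1)
    (E : (Fin n → Fin r × Finset (Fin P)) × (Fin n → Fin n → Bool) → Prop) :
    Pr {ω | E (M.config ω)} ≤
      ENNReal.ofReal (∑ q, if E q then configWeight μ K α q.1 q.2 else 0) := by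
  rw [← Finset.sum_filter, ENNReal.ofReal_sum_of_nonneg
    fun q _ => configWeight_nonneg hμ hα0 hα1 q.1 q.2]
  refine le_trans ?_ (Finset.sum_le_sum fun q _ => M.measure_config_le q)
  refine le_trans (measure_mono ?_) (measure_biUnion_finset_le _ _)
  intro ω h
  simpa using h

theorem HetModel.isolatedOn_config (M : HetModel r n P K μ α Ω Pr) (A : Fin n → Prop)
    (i : Fin r) (ω : Ω) :
    IsolatedOn A i (M.config ω).1 (M.config ω).2 ↔
      ∀ x, A x → M.typ ω x = i ∧ M.Isolated ω x := by
  refine forall₂_congr fun x _ => and_congr_right fun _ => forall_congr' fun y => not_congr ?_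
  refine and_congr_right fun hxy => and_congr_right fun _ => ?_
  rcases lt_or_gt_of_ne hxy with h | h <;> simp [HetModel.config, h, h.not_gt]

theorem HetModel.measure_isolated_eq (M : HetModel r n P K μ α Ω Pr) [IsProbabilityMeasure Pr]
    (hμ : ∀ i, 0 ≤ μ i) (hμsum : ∑ i, μ i = 1) (hK : ∀ i, K i ≤ P)
    (hα0 : ∀ i j, 0 ≤ α i j) (hα1 : ∀ i j, α i j ≤ 1) (A : Fin n → Prop) (i : Fin r) :
    Pr {ω | ∀ x, A x → M.typ ω x = i ∧ M.Isolated ω x} =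
      ENNReal.ofReal (isolatedWeight μ K α P A i) := by
  classical
  simp_rw [← M.isolatedOn_config, ← sum_configWeight_isolatedOn μ K α P A i]
  refine le_antisymm (M.measure_preimage_le hμ hα0 hα1 fun q => IsolatedOn A i q.1 q.2) ?_
  have hc := M.measure_preimage_le hμ hα0 hα1 fun q => ¬ IsolatedOn A i q.1 q.2
  set a := ∑ q : (Fin n → Fin r × Finset (Fin P)) × (Fin n → Fin n → Bool),
    (if IsolatedOn A i q.1 q.2 then configWeight μ K α q.1 q.2 else 0)
  set a' := ∑ q : (Fin n → Fin r × Finset (Fin P)) × (Fin n → Fin n → Bool),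
    (if ¬ IsolatedOn A i q.1 q.2 then configWeight μ K α q.1 q.2 else 0)
  have ha : 0 ≤ a := Finset.sum_nonneg fun q _ => by
    have := configWeight_nonneg (K := K) hμ hα0 hα1 q.1 q.2
    split_ifs <;> simp [this]
  have ha' : 0 ≤ a' := Finset.sum_nonneg fun q _ => by
    have := configWeight_nonneg (K := K) hμ hα0 hα1 q.1 q.2
    split_ifs <;> simp [this]
  have htot : a + a' = 1 := by
    rw [← isolatedWeight_false (α := α) (n := n) hμsum hK i, ← sum_configWeight_isolatedOn,
      ← Finset.sum_add_distrib]
    refine Finset.sum_congr rfl fun q _ => ?_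
    have : IsolatedOn (fun _ => False) i q.1 q.2 := fun _ h => h.elim
    by_cases h : IsolatedOn A i q.1 q.2 <;> simp [h, this]
  have h1 : (1 : ENNReal) ≤ Pr {ω | IsolatedOn A i (M.config ω).1 (M.config ω).2} +
      Pr {ω | ¬ IsolatedOn A i (M.config ω).1 (M.config ω).2} := by
    rw [← measure_univ (μ := Pr)]
    refine le_trans (measure_mono fun ω _ => ?_) (measure_union_le _ _)
    exact em _
  have h2 : ENNReal.ofReal a + ENNReal.ofReal a' = 1 := by
    rw [← ENNReal.ofReal_add ha ha', htot, ENNReal.ofReal_one]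
  rw [← h2] at h1
  exact (ENNReal.add_le_add_iff_right ENNReal.ofReal_ne_top).1
    (h1.trans (add_le_add le_rfl (hc.trans_eq (by congr!))))

open Classical in
theorem isolatedWeight_lt_one (k : ℕ) (i : Fin r) :
    isolatedWeight μ K α P (fun x : Fin (k + 1) => (x : ℕ) < 1) i =
      ∑ v : Fin r × Finset (Fin P), labelWeight μ K v * (if v.1 = i then
        (∑ w, labelWeight μ K w * (1 - edgeProb α v w)) ^ k else 0) := by
  rw [isolatedWeight, ← (Fin.consEquiv fun _ => Fin r × Finset (Fin P)).sum_comp,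
    Fintype.sum_prod_type]
  refine Finset.sum_congr rfl fun v _ => ?_
  simp [Fin.consEquiv, Fin.prod_univ_succ, Fintype.sum_pow, Finset.prod_mul_distrib,
    Finset.mul_sum, mul_assoc]

open Classical in
theorem isolatedWeight_lt_two (k : ℕ) (i : Fin r) :
    isolatedWeight μ K α P (fun x : Fin (k + 2) => (x : ℕ) < 2) i =
      ∑ v : Fin r × Finset (Fin P), labelWeight μ K v * (if v.1 = i then
        ∑ v' : Fin r × Finset (Fin P), labelWeight μ K v' * (if v'.1 = i then
          (1 - edgeProb α v v') *
            (∑ w, labelWeight μ K w * ((1 - edgeProb α v w) * (1 - edgeProb α v' w))) ^ k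
          else 0) else 0) := by
  rw [isolatedWeight, ← (Fin.consEquiv fun _ => Fin r × Finset (Fin P)).sum_comp,
    Fintype.sum_prod_type]
  refine Finset.sum_congr rfl fun v _ => ?_
  rw [← (Fin.consEquiv fun _ => Fin r × Finset (Fin P)).sum_comp, Fintype.sum_prod_type]
  by_cases hv : v.1 = i
  · rw [if_pos hv, Finset.mul_sum]
    refine Finset.sum_congr rfl fun v' _ => ?_
    by_cases hv' : v'.1 = i
    · simp [Fin.consEquiv, Fin.prod_univ_succ, Fintype.sum_pow, Finset.prod_mul_distrib,
        Finset.mul_sum, hv, hv']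
      refine Finset.sum_congr rfl fun s _ => ?_
      ring
    · simp [Fin.consEquiv, Fin.prod_univ_succ, hv']
  · simp [Fin.consEquiv, Fin.prod_univ_succ, hv]

theorem sum_powersetCard_inter_nonempty (S : Finset (Fin P)) (k : ℕ) :
    ∑ T ∈ powersetCard k (univ : Finset (Fin P)), (if (S ∩ T).Nonempty then (1 : ℝ) else 0) =
      P.choose k - (P - S.card).choose k := by
  have h1 : (powersetCard k (univ : Finset (Fin P))).filter (fun T => ¬ (S ∩ T).Nonempty) =
      powersetCard k Sᶜ := by
    ext T
    rw [Finset.mem_filter, Finset.mem_powersetCard, Finset.mem_powersetCard,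
      Finset.not_nonempty_iff_eq_empty, ← Finset.disjoint_iff_inter_eq_empty,
      Finset.subset_compl_iff_disjoint_left]
    simp [and_comm]
  have h2 := Finset.card_filter_add_card_filter_not (s := powersetCard k (univ : Finset (Fin P)))
    (fun T => (S ∩ T).Nonempty)
  rw [h1, Finset.card_powersetCard, Finset.card_powersetCard, Finset.card_compl,
    Finset.card_univ, Fintype.card_fin] at h2
  rw [Finset.sum_boole, ← h2]
  push_cast
  ring

theorem descFactorial_mul_le_sq (N a k : ℕ) :
    N.descFactorial k * (N + 2 * a).descFactorial k ≤ (N + a).descFactorial k ^ 2 := by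
  induction k with
  | zero => simp
  | succ k ih =>
    rw [Nat.descFactorial_succ, Nat.descFactorial_succ, Nat.descFactorial_succ]
    have h : (N - k) * (N + 2 * a - k) ≤ (N + a - k) ^ 2 := by
      rcases le_total N k with h | h
      · simp [Nat.sub_eq_zero_of_le h]
      · obtain ⟨d, rfl⟩ := Nat.exists_eq_add_of_le h
        rw [show k + d - k = d by omega, show k + d + 2 * a - k = d + 2 * a by omega,
          show k + d + a - k = d + a by omega]
        nlinarith [Nat.zero_le (a * a)]
    calc _ = ((N - k) * (N + 2 * a - k)) *
          (N.descFactorial k * (N + 2 * a).descFactorial k) := by ring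
      _ ≤ (N + a - k) ^ 2 * (N + a).descFactorial k ^ 2 := Nat.mul_le_mul h ih
      _ = _ := by ring

theorem choose_mul_choose_le_sq (N a k : ℕ) :
    N.choose k * (N + 2 * a).choose k ≤ (N + a).choose k ^ 2 := by
  have h := descFactorial_mul_le_sq N a k
  simp only [Nat.descFactorial_eq_factorial_mul_choose] at h
  have hk : 0 < k.factorial ^ 2 := pow_pos k.factorial_pos 2
  refine Nat.le_of_mul_le_mul_left ?_ hk
  calc _ = _ := by ring
    _ ≤ _ := h
    _ = _ := by ring

theorem pEdge_eq (hKP : ∀ i, 2 * K i ≤ P) (i j : Fin r) :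
    pEdge P K i j = 1 - ((P - K i).choose (K j) : ℝ) / (P.choose (K j) : ℝ) := by
  have := hKP i
  have := hKP j
  rw [pEdge, if_pos (by omega)]

theorem avg_inter_nonempty (hKP : ∀ i, 2 * K i ≤ P) (i j : Fin r) {S : Finset (Fin P)}
    (hS : S.card = K i) :
    (∑ T ∈ powersetCard (K j) (univ : Finset (Fin P)),
      (if (S ∩ T).Nonempty then (1 : ℝ) else 0)) / (P.choose (K j) : ℝ) = pEdge P K i j := by
  have hC : (P.choose (K j) : ℝ) ≠ 0 := by
    have := hKP j
    exact_mod_cast (Nat.choose_pos (by omega)).ne'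
  rw [sum_powersetCard_inter_nonempty, pEdge_eq hKP, hS, sub_div, div_self hC]

theorem pEdge_nonneg (hKP : ∀ i, 2 * K i ≤ P) (i j : Fin r) : 0 ≤ pEdge P K i j := by
  rw [pEdge_eq hKP, sub_nonneg]
  refine div_le_one_of_le₀ ?_ (Nat.cast_nonneg _)
  exact_mod_cast Nat.choose_le_choose _ (Nat.sub_le _ _)

theorem avg_inter_nonempty_mul_le (hKP : ∀ i, 2 * K i ≤ P) (i j : Fin r)
    {S S' : Finset (Fin P)} (hS : S.card = K i) (hS' : S'.card = K i) (hd : Disjoint S S') :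
    (∑ T ∈ powersetCard (K j) (univ : Finset (Fin P)),
      ((if (S ∩ T).Nonempty then (1 : ℝ) else 0) * (if (S' ∩ T).Nonempty then (1 : ℝ) else 0))) /
        (P.choose (K j) : ℝ) ≤ pEdge P K i j ^ 2 := by
  have hC : (0 : ℝ) < P.choose (K j) := by
    have := hKP j
    exact_mod_cast Nat.choose_pos (by omega)
  have hincl : ∀ T : Finset (Fin P),
      ((if (S ∩ T).Nonempty then (1 : ℝ) else 0) * (if (S' ∩ T).Nonempty then (1 : ℝ) else 0)) =
      (if (S ∩ T).Nonempty then (1 : ℝ) else 0) + (if (S' ∩ T).Nonempty then (1 : ℝ) else 0) -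
        (if ((S ∪ S') ∩ T).Nonempty then (1 : ℝ) else 0) := by
    intro T
    have hu : ((S ∪ S') ∩ T).Nonempty ↔ (S ∩ T).Nonempty ∨ (S' ∩ T).Nonempty := by
      rw [Finset.union_inter_distrib_right, Finset.union_nonempty]
    by_cases h : (S ∩ T).Nonempty <;> by_cases h' : (S' ∩ T).Nonempty <;> simp [hu, h, h']
  simp_rw [hincl]
  rw [Finset.sum_sub_distrib, Finset.sum_add_distrib, sum_powersetCard_inter_nonempty,
    sum_powersetCard_inter_nonempty, sum_powersetCard_inter_nonempty, pEdge_eq hKP,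
    Finset.card_union_of_disjoint hd, hS, hS']
  have hcc := choose_mul_choose_le_sq (P - 2 * K i) (K i) (K j)
  have := hKP i
  rw [show P - 2 * K i + 2 * K i = P by omega, show P - 2 * K i + K i = P - K i by omega] at hcc
  have hcc' : ((P - 2 * K i).choose (K j) : ℝ) * P.choose (K j) ≤
      ((P - K i).choose (K j) : ℝ) ^ 2 := by exact_mod_cast hcc
  rw [show K i + K i = 2 * K i by ring, div_le_iff₀ hC]
  have h3 : ((P - 2 * K i).choose (K j) : ℝ) ≤
      ((P - K i).choose (K j) : ℝ) ^ 2 / P.choose (K j) := (le_div_iff₀ hC).2 hcc'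
  have h4 : (1 - ((P - K i).choose (K j) : ℝ) / P.choose (K j)) ^ 2 * P.choose (K j) =
      P.choose (K j) - 2 * (P - K i).choose (K j) +
        ((P - K i).choose (K j) : ℝ) ^ 2 / P.choose (K j) := by
    field_simp
    ring
  rw [h4]
  linarith

theorem sum_labelWeight_mul_edgeProb (hKP : ∀ i, 2 * K i ≤ P) {v : Fin r × Finset (Fin P)}
    (hv : v.2.card = K v.1) :
    ∑ w, labelWeight μ K w * edgeProb α v w = LamE μ α P K v.1 := by
  rw [sum_labelWeight_mul, LamE]
  refine Finset.sum_congr rfl fun j _ => ?_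
  rw [← avg_inter_nonempty hKP v.1 j hv, ← mul_div_assoc (α v.1 j), Finset.mul_sum]
  simp only [edgeProb, mul_boole]

theorem sum_labelWeight_mul_one_sub (hμsum : ∑ i, μ i = 1) (hKP : ∀ i, 2 * K i ≤ P)
    {v : Fin r × Finset (Fin P)} (hv : v.2.card = K v.1) :
    ∑ w, labelWeight μ K w * (1 - edgeProb α v w) = 1 - LamE μ α P K v.1 := by
  simp only [mul_sub, mul_one, Finset.sum_sub_distrib]
  rw [sum_labelWeight_mul_edgeProb hKP hv,
    sum_labelWeight hμsum fun i => by have := hKP i; omega]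

/-- Probability that a further vertex is adjacent to both of two given vertices. -/
noncomputable def coEdge (μ : Fin r → ℝ) (K : Fin r → ℕ) (α : Fin r → Fin r → ℝ)
    (v v' : Fin r × Finset (Fin P)) : ℝ :=
  ∑ w, labelWeight μ K w * (edgeProb α v w * edgeProb α v' w)

theorem sum_labelWeight_mul_one_sub_mul (hμsum : ∑ i, μ i = 1) (hKP : ∀ i, 2 * K i ≤ P)
    {v v' : Fin r × Finset (Fin P)} (hv : v.2.card = K v.1) (hv' : v'.2.card = K v'.1) :
    ∑ w, labelWeight μ K w * ((1 - edgeProb α v w) * (1 - edgeProb α v' w)) =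
      1 - LamE μ α P K v.1 - LamE μ α P K v'.1 + coEdge μ K α v v' := by
  simp only [mul_sub, sub_mul, mul_one, one_mul, Finset.sum_sub_distrib]
  rw [sum_labelWeight_mul_edgeProb hKP hv, sum_labelWeight_mul_edgeProb hKP hv',
    sum_labelWeight hμsum fun i => by have := hKP i; omega]
  simp only [coEdge]
  ring

theorem coEdge_le_mul (hμ : ∀ i, 0 ≤ μ i) (hKP : ∀ i, 2 * K i ≤ P)
    (hα0 : ∀ i j, 0 ≤ α i j) {v v' : Fin r × Finset (Fin P)} (hv' : v'.2.card = K v'.1)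
    {a : ℝ} (ha : ∀ j, α v.1 j ≤ a) :
    coEdge μ K α v v' ≤ a * LamE μ α P K v'.1 := by
  rw [← sum_labelWeight_mul_edgeProb hKP hv', coEdge, Finset.mul_sum]
  refine Finset.sum_le_sum fun w _ => ?_
  have h0 : 0 ≤ edgeProb α v' w := by
    unfold edgeProb; split_ifs <;> simp [hα0]
  have h1 : edgeProb α v w ≤ a := by
    unfold edgeProb; split_ifs
    · exact ha _
    · exact (hα0 _ _).trans (ha w.1)
  have h2 := labelWeight_nonneg (K := K) hμ w
  calc _ ≤ labelWeight μ K w * (a * edgeProb α v' w) := by gcongr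
    _ = _ := by ring

theorem coEdge_le_sq (hμ : ∀ i, 0 < μ i) (hKP : ∀ i, 2 * K i ≤ P)
    (hα0 : ∀ i j, 0 ≤ α i j) {i : Fin r} {v v' : Fin r × Finset (Fin P)} (hv : v.2.card = K i)
    (hv' : v'.2.card = K i) (hvi : v.1 = i) (hvi' : v'.1 = i)
    (hd : ¬ (v.2 ∩ v'.2).Nonempty) :
    coEdge μ K α v v' ≤ (∑ j, (μ j)⁻¹) * LamE μ α P K i ^ 2 := by
  rw [Finset.not_nonempty_iff_eq_empty, ← Finset.disjoint_iff_inter_eq_empty] at hd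
  have hterm : ∀ j, 0 ≤ μ j * (α i j * pEdge P K i j) := fun j =>
    mul_nonneg (hμ j).le (mul_nonneg (hα0 _ _) (pEdge_nonneg hKP _ _))
  rw [coEdge, sum_labelWeight_mul, Finset.sum_mul]
  refine Finset.sum_le_sum fun j _ => ?_
  have h1 : (∑ S ∈ powersetCard (K j) (univ : Finset (Fin P)),
      edgeProb α v (j, S) * edgeProb α v' (j, S)) / (P.choose (K j) : ℝ) ≤
      α i j ^ 2 * pEdge P K i j ^ 2 := by
    refine le_trans (le_of_eq ?_) (mul_le_mul_of_nonneg_left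
      (avg_inter_nonempty_mul_le hKP i j hv hv' hd) (sq_nonneg (α i j)))
    rw [← mul_div_assoc, Finset.mul_sum]
    congr 1
    refine Finset.sum_congr rfl fun S _ => ?_
    simp only [edgeProb, hvi, hvi']
    split_ifs <;> ring
  have h2 : μ j * (α i j * pEdge P K i j) ≤ LamE μ α P K i :=
    Finset.single_le_sum (f := fun j => μ j * (α i j * pEdge P K i j))
      (fun j _ => hterm j) (Finset.mem_univ j)
  have hμj := hμ j
  calc _ ≤ μ j * (α i j ^ 2 * pEdge P K i j ^ 2) := by gcongr
    _ = (μ j)⁻¹ * (μ j * (α i j * pEdge P K i j)) ^ 2 := by field_simp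
    _ ≤ (μ j)⁻¹ * LamE μ α P K i ^ 2 := by
      have := hterm j
      gcongr

theorem sum_labelWeight_mul_ite (hKP : ∀ i, 2 * K i ≤ P) (i : Fin r) (c : ℝ) :
    ∑ v : Fin r × Finset (Fin P), labelWeight μ K v * (if v.1 = i then c else 0) = μ i * c := by
  rw [sum_labelWeight_mul, Finset.sum_eq_single i]
  · have hC : (P.choose (K i) : ℝ) ≠ 0 := by
      have := hKP i
      exact_mod_cast (Nat.choose_pos (by omega)).ne'
    simp [hC]
  · intro j _ hj
    simp [hj]
  · simp

theorem isolatedWeight_lt_one_eq (hμsum : ∑ i, μ i = 1) (hKP : ∀ i, 2 * K i ≤ P)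
    (k : ℕ) (i : Fin r) :
    isolatedWeight μ K α P (fun x : Fin (k + 1) => (x : ℕ) < 1) i =
      μ i * (1 - LamE μ α P K i) ^ k := by
  rw [isolatedWeight_lt_one, ← sum_labelWeight_mul_ite (P := P) hKP]
  refine Finset.sum_congr rfl fun v _ => ?_
  by_cases hc : v.2.card = K v.1
  · rw [sum_labelWeight_mul_one_sub hμsum hKP hc]
    by_cases hi : v.1 = i
    · simp [hi]
    · simp [hi]
  · simp [labelWeight, hc]

theorem sum_labelWeight_mul_ite_inter (hKP : ∀ i, 2 * K i ≤ P) (i : Fin r)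
    {S : Finset (Fin P)} (hS : S.card = K i) :
    ∑ v : Fin r × Finset (Fin P), labelWeight μ K v *
      (if v.1 = i then (if (S ∩ v.2).Nonempty then 1 else 0) else 0) = μ i * pEdge P K i i := by
  rw [sum_labelWeight_mul, Finset.sum_eq_single i]
  · rw [← avg_inter_nonempty hKP i i hS]
    simp
  · intro j _ hj
    simp [hj]
  · simp

theorem isolatedWeight_lt_two_le (hμ : ∀ i, 0 ≤ μ i) (hμsum : ∑ i, μ i = 1)
    (hKP : ∀ i, 2 * K i ≤ P) (hα0 : ∀ i j, 0 ≤ α i j) (hα1 : ∀ i j, α i j ≤ 1)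
    (k : ℕ) (i : Fin r) {A B : ℝ}
    (hAB : ∀ v v' : Fin r × Finset (Fin P), v.1 = i → v'.1 = i → v.2.card = K i →
      v'.2.card = K i →
      (1 - 2 * LamE μ α P K i + coEdge μ K α v v') ^ k ≤
        A + B * (if (v.2 ∩ v'.2).Nonempty then 1 else 0)) :
    isolatedWeight μ K α P (fun x : Fin (k + 2) => (x : ℕ) < 2) i ≤
      μ i ^ 2 * (A + B * pEdge P K i i) := by
  rw [isolatedWeight_lt_two]
  have he0 : ∀ v v' : Fin r × Finset (Fin P), 0 ≤ edgeProb α v v' := fun v v' => by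
    unfold edgeProb; split_ifs <;> simp [hα0]
  have he1 : ∀ v v' : Fin r × Finset (Fin P), edgeProb α v v' ≤ 1 := fun v v' => by
    unfold edgeProb; split_ifs <;> simp [hα1]
  have hinner : ∀ v : Fin r × Finset (Fin P), v.1 = i → v.2.card = K i →
      ∑ v' : Fin r × Finset (Fin P), labelWeight μ K v' * (if v'.1 = i then
          (1 - edgeProb α v v') *
            (∑ w, labelWeight μ K w * ((1 - edgeProb α v w) * (1 - edgeProb α v' w))) ^ k
          else 0) ≤ μ i * (A + B * pEdge P K i i) := by
    intro v hv hvc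
    calc _ ≤ ∑ v' : Fin r × Finset (Fin P), labelWeight μ K v' * ((if v'.1 = i then A else 0) +
            B * (if v'.1 = i then (if (v.2 ∩ v'.2).Nonempty then 1 else 0) else 0)) := by
          refine Finset.sum_le_sum fun v' _ => ?_
          by_cases hc : v'.2.card = K v'.1
          · refine mul_le_mul_of_nonneg_left ?_ (labelWeight_nonneg hμ _)
            by_cases hv' : v'.1 = i
            · simp only [hv', if_true]
              have hnn : 0 ≤ ∑ w, labelWeight μ K w *
                  ((1 - edgeProb α v w) * (1 - edgeProb α v' w)) :=
                Finset.sum_nonneg fun w _ => mul_nonneg (labelWeight_nonneg hμ _)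
                  (mul_nonneg (sub_nonneg.2 (he1 _ _)) (sub_nonneg.2 (he1 _ _)))
              have hkey := hAB v v' hv hv' hvc (hv' ▸ hc)
              refine (mul_le_of_le_one_left (pow_nonneg hnn k)
                (by linarith [he0 v v'])).trans (le_trans (le_of_eq ?_) hkey)
              rw [sum_labelWeight_mul_one_sub_mul hμsum hKP (hv.symm ▸ hvc) hc, hv, hv']
              ring
            · simp [hv']
          · simp [labelWeight, hc]
      _ = μ i * (A + B * pEdge P K i i) := by
          simp_rw [mul_add, Finset.sum_add_distrib, mul_left_comm _ B]
          rw [← Finset.mul_sum, sum_labelWeight_mul_ite hKP,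
            sum_labelWeight_mul_ite_inter hKP i hvc]
  rw [sq, mul_assoc, ← sum_labelWeight_mul_ite (P := P) hKP]
  refine Finset.sum_le_sum fun v _ => ?_
  by_cases hc : v.2.card = K v.1
  · refine mul_le_mul_of_nonneg_left ?_ (labelWeight_nonneg hμ _)
    by_cases hv : v.1 = i
    · rw [if_pos hv, if_pos hv]
      exact hinner v hv (hv ▸ hc)
    · simp [hv]
  · simp [labelWeight, hc]

theorem LamE_term_nonneg (hμ : ∀ i, 0 ≤ μ i) (hKP : ∀ i, 2 * K i ≤ P)
    (hα0 : ∀ i j, 0 ≤ α i j) (i j : Fin r) : 0 ≤ μ j * (α i j * pEdge P K i j) :=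
  mul_nonneg (hμ j) (mul_nonneg (hα0 _ _) (pEdge_nonneg hKP _ _))

theorem LamE_nonneg (hμ : ∀ i, 0 ≤ μ i) (hKP : ∀ i, 2 * K i ≤ P)
    (hα0 : ∀ i j, 0 ≤ α i j) (i : Fin r) : 0 ≤ LamE μ α P K i :=
  Finset.sum_nonneg fun j _ => LamE_term_nonneg hμ hKP hα0 i j

theorem LamE_term_le (hμ : ∀ i, 0 ≤ μ i) (hKP : ∀ i, 2 * K i ≤ P)
    (hα0 : ∀ i j, 0 ≤ α i j) (i j : Fin r) :
    μ j * (α i j * pEdge P K i j) ≤ LamE μ α P K i :=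
  Finset.single_le_sum (f := fun j => μ j * (α i j * pEdge P K i j))
    (fun j _ => LamE_term_nonneg hμ hKP hα0 i j) (Finset.mem_univ j)

theorem coEdge_nonneg (hμ : ∀ i, 0 ≤ μ i) (hα0 : ∀ i j, 0 ≤ α i j)
    (v v' : Fin r × Finset (Fin P)) : 0 ≤ coEdge μ K α v v' := by
  refine Finset.sum_nonneg fun w _ => mul_nonneg (labelWeight_nonneg hμ w) ?_
  unfold edgeProb
  split_ifs <;> simp [hα0, mul_nonneg]

theorem sq_add_pow_le {L q : ℝ} (hL : L < 1) (hq : 0 ≤ q) (k : ℕ) :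
    ((1 - L) ^ 2 + q) ^ k ≤
      (((1 - L) ^ 2)⁻¹ * Real.exp ((k + 2 : ℕ) * q / (1 - L) ^ 2)) * ((1 - L) ^ (k + 1)) ^ 2 := by
  have h1 : 0 < 1 - L := by linarith
  have h2 : 0 < (1 - L) ^ 2 := by positivity
  have h3 : ((1 - L) ^ 2 + q) ≤ (1 - L) ^ 2 * Real.exp (q / (1 - L) ^ 2) := by
    have := Real.add_one_le_exp (q / (1 - L) ^ 2)
    calc _ = (1 - L) ^ 2 * (q / (1 - L) ^ 2 + 1) := by field_simp; ring
      _ ≤ _ := by gcongr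
  calc _ ≤ ((1 - L) ^ 2 * Real.exp (q / (1 - L) ^ 2)) ^ k := by gcongr
    _ = ((1 - L) ^ 2) ^ k * Real.exp (k * q / (1 - L) ^ 2) := by
        rw [mul_pow, ← Real.exp_nat_mul, mul_div_assoc]
    _ ≤ ((1 - L) ^ 2) ^ k * Real.exp ((k + 2 : ℕ) * q / (1 - L) ^ 2) := by
        gcongr; omega
    _ = _ := by rw [← pow_mul, ← pow_mul, mul_right_comm, show (k + 1) * 2 = 2 + 2 * k by ring,
                  pow_add, inv_mul_cancel_left₀ h2.ne']

theorem one_sub_pow_le {L : ℝ} (hL0 : 0 ≤ L) (hL : L < 1) (k : ℕ) :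
    (1 - L) ^ k ≤
      (((1 - L) ^ 2)⁻¹ * Real.exp ((k + 2 : ℕ) * L / (1 - L))) * ((1 - L) ^ (k + 1)) ^ 2 := by
  have h1 : 0 < 1 - L := by linarith
  have h2 : 0 < (1 - L) ^ 2 := by positivity
  have h3 : 1 ≤ Real.exp (k * (L / (1 - L))) * (1 - L) ^ k := by
    rw [Real.exp_nat_mul, ← mul_pow]
    apply one_le_pow₀
    have := Real.add_one_le_exp (L / (1 - L))
    calc 1 = (L / (1 - L) + 1) * (1 - L) := by field_simp; ring
      _ ≤ _ := by gcongr
  calc (1 - L) ^ k ≤ (1 - L) ^ k * (Real.exp (k * (L / (1 - L))) * (1 - L) ^ k) :=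
        le_mul_of_one_le_right (by positivity) h3
    _ = Real.exp (k * (L / (1 - L))) * ((1 - L) ^ k * (1 - L) ^ k) := by ring
    _ ≤ Real.exp ((k + 2 : ℕ) * (L / (1 - L))) * ((1 - L) ^ k * (1 - L) ^ k) := by
        gcongr; omega
    _ = _ := by
        rw [← mul_div_assoc]
        field_simp
        ring

theorem HetModel.measure_ratio_le (M : HetModel r n P K μ α Ω Pr) [IsProbabilityMeasure Pr]
    (hn : 2 ≤ n) (hμ : ∀ i, 0 < μ i) (hμsum : ∑ i, μ i = 1) (hKP : ∀ i, 2 * K i ≤ P)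
    (hα0 : ∀ i j, 0 ≤ α i j) (hα1 : ∀ i j, α i j ≤ 1) (i : Fin r) {q B : ℝ} (hq : 0 ≤ q)
    (hB : 0 ≤ B) (hL : LamE μ α P K i < 1)
    (hQ : ∀ v v' : Fin r × Finset (Fin P), v.1 = i → v'.1 = i → v.2.card = K i →
      v'.2.card = K i →
      (1 - 2 * LamE μ α P K i + coEdge μ K α v v') ^ (n - 2) ≤
        ((1 - LamE μ α P K i) ^ 2 + q) ^ (n - 2) +
          (B * (1 - LamE μ α P K i) ^ (n - 2)) * (if (v.2 ∩ v'.2).Nonempty then 1 else 0)) :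
    Pr {ω | (M.typ ω (⟨0, by omega⟩ : Fin n) = i ∧ M.Isolated ω (⟨0, by omega⟩ : Fin n)) ∧
          (M.typ ω (⟨1, by omega⟩ : Fin n) = i ∧ M.Isolated ω (⟨1, by omega⟩ : Fin n))} /
        (Pr {ω | M.typ ω (⟨0, by omega⟩ : Fin n) = i ∧
          M.Isolated ω (⟨0, by omega⟩ : Fin n)}) ^ 2 ≤
      ENNReal.ofReal (((1 - LamE μ α P K i) ^ 2)⁻¹ *
        (Real.exp (n * q / (1 - LamE μ α P K i) ^ 2) +
          B * pEdge P K i i * Real.exp (n * LamE μ α P K i / (1 - LamE μ α P K i)))) := by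
  obtain ⟨k, rfl⟩ : ∃ k, n = k + 2 := ⟨n - 2, by omega⟩
  simp only [Nat.add_sub_cancel] at hQ
  have hμ' := fun i => (hμ i).le
  have hK : ∀ i, K i ≤ P := fun i => by have := hKP i; omega
  have hL0 := LamE_nonneg hμ' hKP hα0 i
  have hp := pEdge_nonneg hKP i i
  have htwo := M.measure_isolated_eq hμ' hμsum hK hα0 hα1
    (fun x : Fin (k + 2) => (x : ℕ) < 2) i
  have hone := M.measure_isolated_eq hμ' hμsum hK hα0 hα1
    (fun x : Fin (k + 2) => (x : ℕ) < 1) i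
  rw [isolatedWeight_lt_one_eq hμsum hKP] at hone
  have hle := isolatedWeight_lt_two_le hμ' hμsum hKP hα0 hα1 k i hQ
  have hset2 : {ω | (M.typ ω (⟨0, by omega⟩ : Fin (k + 2)) = i ∧
        M.Isolated ω (⟨0, by omega⟩ : Fin (k + 2))) ∧
        (M.typ ω (⟨1, by omega⟩ : Fin (k + 2)) = i ∧
          M.Isolated ω (⟨1, by omega⟩ : Fin (k + 2)))} =
      {ω | ∀ x : Fin (k + 2), (x : ℕ) < 2 → M.typ ω x = i ∧ M.Isolated ω x} := by
    ext ω
    constructor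
    · rintro ⟨h0, h1⟩ ⟨x, hx⟩ hlt
      have hlt : x < 2 := hlt
      interval_cases x
      · exact h0
      · exact h1
    · intro h
      exact ⟨h _ Nat.zero_lt_two, h _ Nat.one_lt_two⟩
  have hset1 : {ω | M.typ ω (⟨0, by omega⟩ : Fin (k + 2)) = i ∧
        M.Isolated ω (⟨0, by omega⟩ : Fin (k + 2))} =
      {ω | ∀ x : Fin (k + 2), (x : ℕ) < 1 → M.typ ω x = i ∧ M.Isolated ω x} := by
    ext ω
    constructor
    · rintro h0 ⟨x, hx⟩ hlt
      have hlt : x < 1 := hlt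
      interval_cases x
      exact h0
    · intro h
      exact h _ Nat.zero_lt_one
  rw [hset2, hset1, htwo, hone]
  set L := LamE μ α P K i
  have h1L : 0 < 1 - L := by linarith
  have hμi := hμ i
  refine ENNReal.div_le_of_le_mul ?_
  rw [← ENNReal.ofReal_pow (by positivity), ← ENNReal.ofReal_mul (by positivity)]
  refine ENNReal.ofReal_le_ofReal (hle.trans ?_)
  have e1 := sq_add_pow_le hL hq k
  have e2 := mul_le_mul_of_nonneg_left (one_sub_pow_le hL0 hL k) (mul_nonneg hB hp)
  calc _ = μ i ^ 2 * (((1 - L) ^ 2 + q) ^ k + B * pEdge P K i i * (1 - L) ^ k) := by ring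
    _ ≤ μ i ^ 2 * (_ + _) := mul_le_mul_of_nonneg_left (add_le_add e1 e2) (sq_nonneg _)
    _ = _ := by ring

theorem tendsto_log_sq_div_natCast :
    Tendsto (fun n : ℕ => Real.log n ^ 2 / n) atTop (nhds 0) :=
  (Real.isLittleO_pow_log_id_atTop (n := 2)).tendsto_div_nhds_zero.comp
    tendsto_natCast_atTop_atTop

theorem tendsto_log_div_natCast :
    Tendsto (fun n : ℕ => Real.log n / n) atTop (nhds 0) :=
  Real.isLittleO_log_id_atTop.tendsto_div_nhds_zero.comp tendsto_natCast_atTop_atTop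

theorem tendsto_log_sq_div_mul_exp {c : ℝ} (hc : c < 1) :
    Tendsto (fun n : ℕ => Real.log n ^ 2 / n * Real.exp (c * Real.log n)) atTop (nhds 0) := by
  have h := (tendsto_rpow_mul_exp_neg_mul_atTop_nhds_zero 2 (1 - c) (by linarith)).comp
    (Real.tendsto_log_atTop.comp tendsto_natCast_atTop_atTop)
  refine h.congr' ?_
  filter_upwards [eventually_ge_atTop 1] with n hn
  have hn0 : (0 : ℝ) < n := by exact_mod_cast hn
  simp only [Function.comp_apply, Real.rpow_two]
  rw [show -(1 - c) * Real.log n = c * Real.log n - Real.log n by ring, Real.exp_sub,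
    Real.exp_log hn0]
  ring

/-- The second-moment ratio is asymptotically controlled by bounds `q` for the probability of a
common neighbour and `B` for the contribution of overlapping key rings. -/
theorem tendsto_ratio_bound {L q B p : ℕ → ℝ} (hL : Tendsto L atTop (nhds 0))
    (hq : Tendsto (fun n => n * q n) atTop (nhds 0))
    (hB : Tendsto (fun n => B n * p n * Real.exp (n * L n / (1 - L n))) atTop (nhds 0)) :
    Tendsto (fun n => ((1 - L n) ^ 2)⁻¹ * (Real.exp (n * q n / (1 - L n) ^ 2) +
      B n * p n * Real.exp (n * L n / (1 - L n)))) atTop (nhds 1) := by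
  have h1 : Tendsto (fun n => (1 - L n) ^ 2) atTop (nhds 1) := by
    simpa using (hL.const_sub 1).pow 2
  have h2 : Tendsto (fun n => Real.exp (n * q n / (1 - L n) ^ 2)) atTop (nhds 1) := by
    have := (Real.continuous_exp.tendsto _).comp (hq.div h1 one_ne_zero)
    simpa [Function.comp_def] using this
  simpa using (h1.inv₀ one_ne_zero).mul (h2.add hB)

/-- Vanishing of the contribution of overlapping key rings. -/
theorem tendsto_overlap {L c p a : ℕ → ℝ} {c₀ D δ : ℝ} (hc₀ : c₀ < 1) (hδ : 0 < δ)
    (hc : Tendsto c atTop (nhds c₀)) (hL : Tendsto L atTop (nhds 0))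
    (hLc : ∀ᶠ n in atTop, L n = c n * Real.log n / n) (hp0 : ∀ n, 0 ≤ p n)
    (hpL : ∀ n, a n * p n ≤ D * L n) (ha : ∀ᶠ n in atTop, δ < a n * Real.log n) :
    Tendsto (fun n => p n * Real.exp (n * L n / (1 - L n))) atTop (nhds 0) := by
  obtain ⟨c', hc', hc'1⟩ := exists_between hc₀
  have hquot : Tendsto (fun n => c n / (1 - L n)) atTop (nhds c₀) := by
    simpa [Pi.div_def] using hc.div (hL.const_sub 1) (by norm_num)
  have hlim : Tendsto (fun n : ℕ => D / δ * (c n *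
      (Real.log n ^ 2 / n * Real.exp (c' * Real.log n)))) atTop (nhds 0) := by
    simpa using (hc.mul (tendsto_log_sq_div_mul_exp hc'1)).const_mul (D / δ)
  refine tendsto_of_tendsto_of_tendsto_of_le_of_le' tendsto_const_nhds hlim
    (Eventually.of_forall fun n => mul_nonneg (hp0 n) (Real.exp_pos _).le) ?_
  filter_upwards [hLc, ha, hquot.eventually_lt_const hc', eventually_ge_atTop 1]
    with n hLn han hqn hn
  have hn0 : (0 : ℝ) < n := by exact_mod_cast hn
  have hlog : 0 ≤ Real.log n := Real.log_natCast_nonneg n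
  have hexp : Real.exp (n * L n / (1 - L n)) ≤ Real.exp (c' * Real.log n) := by
    refine Real.exp_le_exp.2 ?_
    have : n * L n / (1 - L n) = c n / (1 - L n) * Real.log n := by
      have : (n : ℝ) * L n = c n * Real.log n := by rw [hLn]; field_simp
      rw [this]; ring
    rw [this]
    gcongr
  have hpn : p n ≤ D / δ * (c n * (Real.log n ^ 2 / n)) := by
    have h1 : p n * δ ≤ D * L n * Real.log n := by
      calc p n * δ ≤ p n * (a n * Real.log n) := mul_le_mul_of_nonneg_left han.le (hp0 n)
        _ = a n * p n * Real.log n := by ring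
        _ ≤ D * L n * Real.log n := mul_le_mul_of_nonneg_right (hpL n) hlog
    rw [← le_div_iff₀ hδ] at h1
    refine h1.trans (le_of_eq ?_)
    rw [hLn]
    ring
  calc _ ≤ D / δ * (c n * (Real.log n ^ 2 / n)) * Real.exp (c' * Real.log n) :=
        mul_le_mul hpn hexp (Real.exp_pos _).le ((hp0 n).trans hpn)
    _ = _ := by ring

/-- under any scaling with `Λ_m(n) = c_n log n / n`,
`c_n → c ∈ (0,1)`, and condition (a) `α_{md}(n) log n → 0` or (b)
`α_{md}(n) log n → α* ∈ (0,∞]` and `α_{mm}(n) log n → α** ∈ (0,∞]`, the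
second-moment ratio `E[x_{n,1} x_{n,2}]/E[x_{n,1}]²` has `limsup ≤ 1`, where
`x_{n,ℓ}` indicates that vertex `v_ℓ` of `H(n; μ, Θ_n)` has type `m(n)` and
is isolated. -/
theorem second_moment_ratio_limsup
    (hr : 0 < r)
    (hμpos : ∀ i, 0 < μ i) (hμsum : ∑ i, μ i = 1)
    (Pn : ℕ → ℕ) (Kn : ℕ → Fin r → ℕ)
    (hKpos : ∀ n i, 1 ≤ Kn n i)
    (hKmono : ∀ n, Monotone (Kn n))
    (hKP : ∀ n i, 2 * Kn n i ≤ Pn n)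
    (αn : ℕ → Fin r → Fin r → ℝ)
    (hα0 : ∀ n i j, 0 < αn n i j) (hα1 : ∀ n i j, αn n i j < 1)
    (hαsymm : ∀ n i j, αn n i j = αn n j i)
    (c : ℝ) (hc0 : 0 < c) (hc1 : c < 1) (cn : ℕ → ℝ)
    (hcn : Tendsto cn atTop (nhds c))
    (hscal : ∀ n, 2 ≤ n →
      LamMin μ (αn n) (Pn n) (Kn n) = cn n * Real.log n / n)
    (m : ℕ → Fin r)
    (hm : ∀ n i, LamE μ (αn n) (Pn n) (Kn n) (m n) ≤ LamE μ (αn n) (Pn n) (Kn n) i)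
    (hcond :
      (Tendsto (fun n => ENNReal.ofReal ((⨆ j, αn n (m n) j) * Real.log n))
          atTop (nhds 0)) ∨
      (∃ αstar αstarstar : ENNReal, αstar ≠ 0 ∧ αstarstar ≠ 0 ∧
        Tendsto (fun n => ENNReal.ofReal ((⨆ j, αn n (m n) j) * Real.log n))
          atTop (nhds αstar) ∧
        Tendsto (fun n => ENNReal.ofReal (αn n (m n) (m n) * Real.log n))
          atTop (nhds αstarstar)))
    (Ω : ℕ → Type) [mΩ : ∀ n, MeasurableSpace (Ω n)]
    (Pr : ∀ n, Measure (Ω n)) (hPr : ∀ n, IsProbabilityMeasure (Pr n))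
    (M : ∀ n, HetModel r n (Pn n) (Kn n) μ (αn n) (Ω n) (Pr n)) :
    Filter.limsup
      (fun (k : ℕ) => if h : 2 ≤ k then
          Pr k {ω | ((M k).typ ω (⟨0, by omega⟩ : Fin k) = m k ∧
                      (M k).Isolated ω (⟨0, by omega⟩ : Fin k)) ∧
                    ((M k).typ ω (⟨1, by omega⟩ : Fin k) = m k ∧
                      (M k).Isolated ω (⟨1, by omega⟩ : Fin k))} /
            (Pr k {ω | (M k).typ ω (⟨0, by omega⟩ : Fin k) = m k ∧
                      (M k).Isolated ω (⟨0, by omega⟩ : Fin k)}) ^ 2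
        else 0)
      atTop ≤ (1 : ENNReal) := by
  have : Nonempty (Fin r) := ⟨⟨0, hr⟩⟩
  have hμ0 := fun i => (hμpos i).le
  have hα0' := fun n i j => (hα0 n i j).le
  have hα1' := fun n i j => (hα1 n i j).le
  set L : ℕ → ℝ := fun n => LamE μ (αn n) (Pn n) (Kn n) (m n)
  set p : ℕ → ℝ := fun n => pEdge (Pn n) (Kn n) (m n) (m n)
  set D : ℝ := ∑ j, (μ j)⁻¹
  have hD0 : 0 ≤ D := Finset.sum_nonneg fun j _ => inv_nonneg.2 (hμ0 j)
  have hLnn : ∀ n, 0 ≤ L n := fun n => LamE_nonneg hμ0 (hKP n) (hα0' n) _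
  have hLc : ∀ᶠ n in atTop, L n = cn n * Real.log n / n := by
    filter_upwards [eventually_ge_atTop 2] with n hn
    rw [← hscal n hn, LamMin]
    exact le_antisymm (le_ciInf (hm n)) (ciInf_le (Set.finite_range _).bddBelow _)
  have hnL : ∀ᶠ n : ℕ in atTop, n * L n = cn n * Real.log n := by
    filter_upwards [hLc, eventually_ge_atTop 1] with n h hn
    have hn0 : (0 : ℝ) < n := by exact_mod_cast hn
    rw [h]
    field_simp
  have hL : Tendsto L atTop (nhds 0) := by
    have h := hcn.mul tendsto_log_div_natCast
    rw [mul_zero] at h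
    refine h.congr' ?_
    filter_upwards [hLc] with n hn
    rw [hn, mul_div_assoc]
  have main : ∃ q B : ℕ → ℝ, (∀ n, 0 ≤ q n) ∧ (∀ n, 0 ≤ B n) ∧
      Tendsto (fun n => n * q n) atTop (nhds 0) ∧
      Tendsto (fun n => B n * p n * Real.exp (n * L n / (1 - L n))) atTop (nhds 0) ∧
      ∀ n, 2 * L n ≤ 1 → ∀ v v' : Fin r × Finset (Fin (Pn n)), v.1 = m n → v'.1 = m n →
        v.2.card = Kn n (m n) → v'.2.card = Kn n (m n) →
        (1 - 2 * L n + coEdge μ (Kn n) (αn n) v v') ^ (n - 2) ≤ ((1 - L n) ^ 2 + q n) ^ (n - 2) +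
          (B n * (1 - L n) ^ (n - 2)) * (if (v.2 ∩ v'.2).Nonempty then 1 else 0) := by
    rcases hcond with ha | ⟨_, β, -, hβ, -, hb⟩
    · have hle : ∀ n j, αn n (m n) j ≤ ⨆ j, αn n (m n) j := fun n j =>
        le_ciSup (Set.finite_range _).bddAbove j
      have hsup : ∀ n, 0 ≤ ⨆ j, αn n (m n) j := fun n => (hα0' n _ (m n)).trans (hle n _)
      refine ⟨fun n => (⨆ j, αn n (m n) j) * L n, fun _ => 0,
        fun n => mul_nonneg (hsup n) (hLnn n), fun _ => le_rfl, ?_, by simp, ?_⟩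
      · have h := ((ENNReal.tendsto_toReal ENNReal.zero_ne_top).comp ha).mul hcn
        simp only [ENNReal.toReal_zero, zero_mul] at h
        refine h.congr' ?_
        filter_upwards [hnL] with n hn
        rw [Function.comp_apply, ENNReal.toReal_ofReal
          (mul_nonneg (hsup n) (Real.log_natCast_nonneg n)), mul_left_comm, hn]
        ring
      · intro n hLn v v' hv hv' hvc hvc'
        have h := coEdge_le_mul (α := αn n) hμ0 (hKP n) (hα0' n) (v := v) (v' := v')
          (by rw [hv', hvc']) (by rw [hv]; exact hle n)
        rw [hv'] at h
        have h0 := coEdge_nonneg (K := Kn n) hμ0 (hα0' n) v v'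
        simp only [zero_mul, add_zero]
        refine pow_le_pow_left₀ (by linarith) ?_ _
        nlinarith [sq_nonneg (L n)]
    · obtain ⟨δ, hδ, hδβ⟩ := ENNReal.lt_iff_exists_nnreal_btwn.1 (pos_iff_ne_zero.2 hβ)
      refine ⟨fun n => D * L n ^ 2, fun _ => 1, fun n => mul_nonneg hD0 (sq_nonneg _),
        fun _ => zero_le_one, ?_, ?_, ?_⟩
      · have h := ((hcn.mul hcn).mul tendsto_log_sq_div_natCast).const_mul D
        simp only [mul_zero] at h
        refine h.congr' ?_
        filter_upwards [hnL, hLc] with n hn hn'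
        calc _ = D * ((cn n * Real.log n) * (cn n * Real.log n / n)) := by ring
          _ = D * ((n * L n) * L n) := by rw [hn, ← hn']
          _ = _ := by ring
      · simp only [one_mul]
        refine tendsto_overlap (a := fun n => αn n (m n) (m n)) (D := D) hc1 (NNReal.coe_pos.2
          (ENNReal.coe_pos.1 hδ)) hcn hL hLc (fun n => pEdge_nonneg (hKP n) _ _) ?_ ?_
        · intro n
          have h1 := LamE_term_le hμ0 (hKP n) (hα0' n) (m n) (m n)
          have h2 : (μ (m n))⁻¹ ≤ D := Finset.single_le_sum (f := fun j => (μ j)⁻¹)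
            (fun j _ => inv_nonneg.2 (hμ0 j)) (Finset.mem_univ (m n))
          calc αn n (m n) (m n) * p n
              = (μ (m n))⁻¹ * (μ (m n) * (αn n (m n) (m n) * p n)) := by
                rw [inv_mul_cancel_left₀ (hμpos _).ne']
            _ ≤ D * L n := mul_le_mul h2 h1 (LamE_term_nonneg hμ0 (hKP n) (hα0' n) _ _) hD0
        · filter_upwards [hb.eventually_const_lt hδβ] with n hn
          rw [← ENNReal.ofReal_coe_nnreal] at hn
          exact (ENNReal.ofReal_lt_ofReal_iff'.1 hn).1
      · intro n hLn v v' hv hv' hvc hvc'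
        have h0 := coEdge_nonneg (K := Kn n) hμ0 (hα0' n) v v'
        by_cases hne : (v.2 ∩ v'.2).Nonempty
        · have h := coEdge_le_mul (α := αn n) hμ0 (hKP n) (hα0' n) (v := v) (v' := v')
            (by rw [hv', hvc']) (hα1' n v.1)
          rw [hv', one_mul] at h
          rw [if_pos hne, mul_one, one_mul]
          refine le_add_of_nonneg_of_le (pow_nonneg (by positivity) _)
            (pow_le_pow_left₀ (by linarith) (by linarith) _)
        · have h := coEdge_le_sq hμpos (hKP n) (hα0' n) hvc hvc' hv hv' hne
          rw [if_neg hne, mul_zero, add_zero]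
          refine pow_le_pow_left₀ (by linarith) ?_ _
          nlinarith [sq_nonneg (L n)]
  obtain ⟨q, B, hq0, hB0, hq, hB, hQ⟩ := main
  have hlim := ENNReal.tendsto_ofReal (tendsto_ratio_bound hL hq hB)
  rw [ENNReal.ofReal_one] at hlim
  rw [← hlim.limsup_eq]
  refine limsup_le_limsup ?_
  filter_upwards [eventually_ge_atTop 2, hL.eventually_lt_const one_half_pos] with n hn hLn
  rw [dif_pos hn]
  have := hPr n
  exact (M n).measure_ratio_le hn hμpos hμsum (hKP n) (hα0' n) (hα1' n) (m n) (hq0 n) (hB0 n)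
    (by change L n < 1; linarith) (hQ n (by linarith))
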